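/- arXiv:2605.23442 — 5 statements merged into one kernel-verified Lean document; each statement's English description precedes it below -/
import Mathlib

section
/- Let H be a finite-dimensional complex inner product space and let W be a unitary operator on H admitting a spectral decomposition W = Π₀ + Σ_{j=1}^m e^{iθ_j} Π_j, where Π₀, Π₁, …, Π_m are pairwise orthogonal orthogonal projections summing to the identity and θ_1, …, θ_m ∈ ℝ. Let ε ∈ (0,1) and let Υ ∈ ℂ[X] be a polynomial with Υ(1) = 1 and |Υ(e^{iθ_j})| ≤ ε for every j ∈ {1, …, m}. Then the operator norm satisfies ‖Υ(W) − Π₀‖ ≤ ε, where Υ(W) denotes the evaluation of the polynomial Υ at the operator W. -/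
/-- If `a * q = c • q`, then `p(a) * q = p(c) • q` for every polynomial `p`. -/
theorem aeval_mul_eq_eval_smul {R A : Type*} [CommSemiring R] [Semiring A] [Algebra R A]
    {a q : A} {c : R} (h : a * q = c • q) (p : Polynomial R) :
    Polynomial.aeval a p * q = p.eval c • q := by
  have hpow (n : ℕ) : a ^ n * q = c ^ n • q := by
    induction n with
    | zero => simp
    | succ n ih => rw [pow_succ, mul_assoc, h, mul_smul_comm, ih, smul_smul, pow_succ']
  induction p using Polynomial.induction_on' with
  | add p r hp hr => rw [map_add, add_mul, hp, hr, Polynomial.eval_add, add_smul]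
  | monomial n b =>
    rw [Polynomial.aeval_monomial, Polynomial.eval_monomial, mul_assoc, hpow,
      ← Algebra.smul_def, smul_smul]

/-- Pythagoras for a finite family of pairwise orthogonal vectors. -/
theorem norm_sq_sum_of_pairwise_inner_eq_zero {𝕜 E ι : Type*} [RCLike 𝕜]
    [NormedAddCommGroup E] [InnerProductSpace 𝕜 E] [Fintype ι] (v : ι → E)
    (hv : ∀ i j, i ≠ j → inner 𝕜 (v i) (v j) = 0) :
    ‖∑ i, v i‖ ^ 2 = ∑ i, ‖v i‖ ^ 2 := by
  rw [← inner_self_eq_norm_sq (𝕜 := 𝕜), sum_inner, map_sum]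
  refine Finset.sum_congr rfl fun i _ => ?_
  rw [inner_sum, Finset.sum_eq_single i (fun j _ hj => hv i j hj.symm) (by simp),
    inner_self_eq_norm_sq]

section OrthogonalProjections

variable {𝕜 E ι : Type*} [RCLike 𝕜] [NormedAddCommGroup E] [InnerProductSpace 𝕜 E]
  [CompleteSpace E]

/-- Orthogonal projections whose product vanishes have orthogonal ranges. -/
theorem inner_apply_apply_eq_zero_of_mul_eq_zero {P Q : E →L[𝕜] E}
    (hP : ContinuousLinearMap.adjoint P = P) (h : P * Q = 0) (x y : E) :
    inner 𝕜 (P x) (Q y) = 0 := by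
  rw [← hP, ContinuousLinearMap.adjoint_inner_left, ← mul_apply_eq_comp, h,
    zero_apply, inner_zero_right]

/-- If pairwise orthogonal projections `P j` are completed to a resolution of the identity by `P0`,
then `∑ j, c j • P j` has norm at most any nonnegative bound on the `‖c j‖`. -/
theorem norm_sum_smul_orthogonal_projections_le [Fintype ι] {P0 : E →L[𝕜] E} {P : ι → E →L[𝕜] E}
    (hP0sa : ContinuousLinearMap.adjoint P0 = P0)
    (hPsa : ∀ j, ContinuousLinearMap.adjoint (P j) = P j)
    (hP0P : ∀ j, P0 * P j = 0) (hPP : ∀ i j, i ≠ j → P i * P j = 0)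
    (hsum : P0 + ∑ j, P j = 1) {c : ι → 𝕜} {r : ℝ} (hr : 0 ≤ r) (hc : ∀ j, ‖c j‖ ≤ r) :
    ‖∑ j, c j • P j‖ ≤ r := by
  refine ContinuousLinearMap.opNorm_le_bound _ hr fun x => ?_
  have horth (i j : ι) (hij : i ≠ j) : inner 𝕜 (P i x) (P j x) = 0 :=
    inner_apply_apply_eq_zero_of_mul_eq_zero (hPsa i) (hPP i j hij) x x
  have hx : P0 x + ∑ j, P j x = x := by
    simpa [sum_apply] using congrArg (fun T : E →L[𝕜] E => T x) hsum
  have horth0 : inner 𝕜 (P0 x) (∑ j, P j x) = 0 := by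
    rw [inner_sum]
    exact Finset.sum_eq_zero fun j _ =>
      inner_apply_apply_eq_zero_of_mul_eq_zero hP0sa (hP0P j) x x
  have hbessel : ∑ j, ‖P j x‖ ^ 2 ≤ ‖x‖ ^ 2 := by
    have h := norm_add_sq_eq_norm_sq_add_norm_sq_of_inner_eq_zero _ _ horth0
    rw [hx] at h
    rw [← norm_sq_sum_of_pairwise_inner_eq_zero (𝕜 := 𝕜) _ horth]
    nlinarith [mul_self_nonneg ‖P0 x‖]
  refine (sq_le_sq₀ (norm_nonneg _) (by positivity)).1 ?_
  calc ‖(∑ j, c j • P j) x‖ ^ 2 = ‖∑ j, c j • P j x‖ ^ 2 := by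
        simp
    _ = ∑ j, ‖c j • P j x‖ ^ 2 :=
        norm_sq_sum_of_pairwise_inner_eq_zero (𝕜 := 𝕜) _ fun i j hij => by
          rw [inner_smul_left, inner_smul_right, horth i j hij, mul_zero, mul_zero]
    _ ≤ ∑ j, r ^ 2 * ‖P j x‖ ^ 2 := by
        refine Finset.sum_le_sum fun j _ => ?_
        rw [norm_smul, mul_pow]
        gcongr
        exact hc j
    _ = r ^ 2 * ∑ j, ‖P j x‖ ^ 2 := (Finset.mul_sum _ _ _).symm
    _ ≤ r ^ 2 * ‖x‖ ^ 2 := by gcongr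
    _ = (r * ‖x‖) ^ 2 := (mul_pow _ _ _).symm

end OrthogonalProjections

/-- **GQSP projector error bound.**
If a unitary `W` on a finite-dimensional complex inner product space has spectral
decomposition `W = Π₀ + ∑ⱼ e^{iθⱼ} Πⱼ` (pairwise orthogonal orthogonal projections
summing to the identity), and `Υ` is a polynomial with `Υ(1) = 1` and
`|Υ(e^{iθⱼ})| ≤ ε` for all `j`, then `‖Υ(W) − Π₀‖ ≤ ε`. -/
theorem gqsp_projector_error_bound
    {H : Type*} [NormedAddCommGroup H] [InnerProductSpace ℂ H]
    [FiniteDimensional ℂ H]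
    (m : ℕ) (W P0 : H →L[ℂ] H) (P : Fin m → H →L[ℂ] H) (θ : Fin m → ℝ)
    (hW : W ∈ unitary (H →L[ℂ] H))
    (hP0idem : P0 * P0 = P0)
    (hP0sa : ContinuousLinearMap.adjoint P0 = P0)
    (hPidem : ∀ j, P j * P j = P j)
    (hPsa : ∀ j, ContinuousLinearMap.adjoint (P j) = P j)
    (hP0P : ∀ j, P0 * P j = 0) (hPP0 : ∀ j, P j * P0 = 0)
    (hPP : ∀ i j, i ≠ j → P i * P j = 0)
    (hsum : P0 + ∑ j, P j = 1)
    (hspec : W = P0 + ∑ j, Complex.exp ((θ j : ℂ) * Complex.I) • P j)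
    (ε : ℝ) (hε0 : 0 < ε) (hε1 : ε < 1)
    (Υ : Polynomial ℂ)
    (hΥ1 : Υ.eval 1 = 1)
    (hΥθ : ∀ j, ‖Υ.eval (Complex.exp ((θ j : ℂ) * Complex.I))‖ ≤ ε) :
    ‖(Polynomial.aeval W) Υ - P0‖ ≤ ε := by
  have hWP0 : W * P0 = (1 : ℂ) • P0 := by
    rw [hspec, add_mul, hP0idem, Finset.sum_mul, one_smul]
    simp [hPP0]
  have hWP (j : Fin m) : W * P j = Complex.exp ((θ j : ℂ) * Complex.I) • P j := by
    rw [hspec, add_mul, hP0P, zero_add, Finset.sum_mul,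
      Finset.sum_eq_single j (fun i _ hij => by rw [smul_mul_assoc, hPP i j hij, smul_zero])
        (by simp), smul_mul_assoc, hPidem]
  have haeval : Polynomial.aeval W Υ - P0 =
      ∑ j, Υ.eval (Complex.exp ((θ j : ℂ) * Complex.I)) • P j := by
    rw [← mul_one (Polynomial.aeval W Υ), ← hsum, mul_add, Finset.mul_sum,
      aeval_mul_eq_eval_smul hWP0, hΥ1, one_smul, add_sub_cancel_left]
    exact Finset.sum_congr rfl fun j _ => aeval_mul_eq_eval_smul (hWP j) Υ
  rw [haeval]
  exact norm_sum_smul_orthogonal_projections_le hP0sa hPsa hP0P hPP hsum hε0.le hΥθ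
end

section
/- Let H be a finite-dimensional complex inner product space, let C be a unitary operator on ℂ² ⊗ H, and let Υ, Φ be linear operators on H such that C(|0⟩ ⊗ v) = |0⟩ ⊗ (Υ v) + |1⟩ ⊗ (Φ v) for all v ∈ H. Fix φ ∈ ℝ, let P_φ := e^{iφ}|0⟩⟨0| + |1⟩⟨1| be the phase gate on ℂ², and set S̃ := C† (P_φ ⊗ I) C. Then the top-left block of S̃ satisfies (⟨0| ⊗ I) S̃ (|0⟩ ⊗ I) = I + (e^{iφ} − 1) Q, where Q := Υ†Υ. -/
/- We model the tensor product `ℂ² ⊗ H` by the L²-product `WithLp 2 (H × H)`,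
identifying `|0⟩ ⊗ v` with `(v, 0)` and `|1⟩ ⊗ v` with `(0, v)`. -/

noncomputable section

variable {H : Type*} [NormedAddCommGroup H] [InnerProductSpace ℂ H]

/-- The embedding `|0⟩ ⊗ I : H → ℂ² ⊗ H`, `v ↦ |0⟩ ⊗ v`. -/
def ket0 : H →L[ℂ] WithLp 2 (H × H) :=
  (WithLp.prodContinuousLinearEquiv 2 ℂ H H).symm.toContinuousLinearMap.comp
    (ContinuousLinearMap.inl ℂ H H)

/-- The embedding `|1⟩ ⊗ I : H → ℂ² ⊗ H`, `v ↦ |1⟩ ⊗ v`. -/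
def ket1 : H →L[ℂ] WithLp 2 (H × H) :=
  (WithLp.prodContinuousLinearEquiv 2 ℂ H H).symm.toContinuousLinearMap.comp
    (ContinuousLinearMap.inr ℂ H H)

/-- The block projection `⟨0| ⊗ I : ℂ² ⊗ H → H`, `|k⟩ ⊗ v ↦ δ_{0k} v`. -/
def bra0 : WithLp 2 (H × H) →L[ℂ] H :=
  (ContinuousLinearMap.fst ℂ H H).comp
    (WithLp.prodContinuousLinearEquiv 2 ℂ H H).toContinuousLinearMap

/-- The block projection `⟨1| ⊗ I : ℂ² ⊗ H → H`, `|k⟩ ⊗ v ↦ δ_{1k} v`. -/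
def bra1 : WithLp 2 (H × H) →L[ℂ] H :=
  (ContinuousLinearMap.snd ℂ H H).comp
    (WithLp.prodContinuousLinearEquiv 2 ℂ H H).toContinuousLinearMap

/-- The phase gate `P_φ ⊗ I = (e^{iφ}|0⟩⟨0| + |1⟩⟨1|) ⊗ I` on `ℂ² ⊗ H`. -/
def phaseGate (φ : ℝ) : WithLp 2 (H × H) →L[ℂ] WithLp 2 (H × H) :=
  Complex.exp ((φ : ℂ) * Complex.I) • ((ket0 (H := H)).comp bra0) + (ket1 (H := H)).comp bra1

/-- **Top-left block of the compiled selective phase.**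
If `C` is unitary on `ℂ² ⊗ H` with `C(|0⟩ ⊗ v) = |0⟩ ⊗ Υv + |1⟩ ⊗ Φv` and
`S̃ := C†(P_φ ⊗ I)C`, then `(⟨0| ⊗ I) S̃ (|0⟩ ⊗ I) = I + (e^{iφ} − 1) Q` with `Q = Υ†Υ`. -/
theorem compiled_selective_phase_top_left_block
    {H : Type*} [NormedAddCommGroup H] [InnerProductSpace ℂ H] [FiniteDimensional ℂ H]
    (C : WithLp 2 (H × H) →L[ℂ] WithLp 2 (H × H))
    (hC : C ∈ unitary (WithLp 2 (H × H) →L[ℂ] WithLp 2 (H × H)))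
    (Υ Φ : H →L[ℂ] H)
    (hblock : ∀ v : H, C (ket0 v) = ket0 (Υ v) + ket1 (Φ v))
    (φ : ℝ)
    (Stilde : WithLp 2 (H × H) →L[ℂ] WithLp 2 (H × H))
    (hS : Stilde = ContinuousLinearMap.adjoint C * phaseGate φ * C)
    (Q : H →L[ℂ] H) (hQ : Q = ContinuousLinearMap.adjoint Υ * Υ) :
    bra0.comp (Stilde.comp ket0) = 1 + (Complex.exp ((φ : ℂ) * Complex.I) - 1) • Q := by
  have hinner : ∀ v w : H, inner ℂ w v = inner ℂ (Υ w) (Υ v) + inner ℂ (Φ w) (Φ v) := by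
    intro v w
    have h : inner ℂ (C (ket0 w)) (C (ket0 v)) = inner ℂ (ket0 w) (ket0 v) :=
      ContinuousLinearMap.inner_map_map_of_mem_unitary hC _ _
    rw [hblock, hblock] at h
    simpa [ket0, ket1, WithLp.prod_inner_apply] using h.symm
  subst hQ
  ext v
  refine ext_inner_left ℂ fun w => ?_
  have hadj : ∀ x : WithLp 2 (H × H), inner ℂ w (bra0 x) = inner ℂ (ket0 w) x := fun x => by
    simp [ket0, bra0, WithLp.prod_inner_apply]
  have hcompress : inner ℂ w (bra0 (Stilde (ket0 v))) =
      inner ℂ (C (ket0 w)) (phaseGate φ (C (ket0 v))) := by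
    rw [hadj, hS, mul_apply_eq_comp, mul_apply_eq_comp,
      ContinuousLinearMap.adjoint_inner_right]
  rw [ContinuousLinearMap.comp_apply, ContinuousLinearMap.comp_apply, hcompress, hblock, hblock]
  simp only [add_apply, one_apply_eq_self,
    smul_apply, mul_apply_eq_comp, inner_add_right,
    inner_smul_right, ContinuousLinearMap.adjoint_inner_right, hinner v w]
  simp [phaseGate, ket0, ket1, bra0, bra1, WithLp.prod_inner_apply]
  ring
end
end

section
/- Let H be a finite-dimensional complex inner product space, let C be a unitary operator on ℂ² ⊗ H, and let Υ, Φ be linear operators on H such that C(|0⟩ ⊗ v) = |0⟩ ⊗ (Υ v) + |1⟩ ⊗ (Φ v) for all v ∈ H. Fix φ ∈ ℝ, let P_φ := e^{iφ}|0⟩⟨0| + |1⟩⟨1|, set S̃ := C† (P_φ ⊗ I) C, Q := Υ†Υ, and B := (⟨1| ⊗ I) S̃ (|0⟩ ⊗ I). Then B†B = |e^{iφ} − 1|² (Q − Q²). -/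
/- We model the tensor product `ℂ² ⊗ H` by the L²-product `WithLp 2 (H × H)`,
identifying `|0⟩ ⊗ v` with `(v, 0)` and `|1⟩ ⊗ v` with `(0, v)`. -/

noncomputable section

variable {H : Type*} [NormedAddCommGroup H] [InnerProductSpace ℂ H]

open scoped InnerProductSpace

lemma inner_ket0_left {H : Type*} [NormedAddCommGroup H] [InnerProductSpace ℂ H]
    (u : H) (w : WithLp 2 (H × H)) : ⟪ket0 u, w⟫_ℂ = ⟪u, bra0 w⟫_ℂ := by
  simp [ket0, bra0, WithLp.prod_inner_apply]

lemma inner_bra1_bra1 {H : Type*} [NormedAddCommGroup H] [InnerProductSpace ℂ H]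
    (x y : WithLp 2 (H × H)) :
    ⟪bra1 x, bra1 y⟫_ℂ = ⟪x, y⟫_ℂ - ⟪bra0 x, bra0 y⟫_ℂ := by
  simp [bra0, bra1, WithLp.prod_inner_apply]

lemma bra0_ket0 {H : Type*} [NormedAddCommGroup H] [InnerProductSpace ℂ H] (v : H) :
    bra0 (ket0 v) = v := rfl

lemma bra1_ket0 {H : Type*} [NormedAddCommGroup H] [InnerProductSpace ℂ H] (v : H) :
    bra1 (ket0 v) = 0 := rfl

lemma bra0_ket1 {H : Type*} [NormedAddCommGroup H] [InnerProductSpace ℂ H] (v : H) :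
    bra0 (ket1 v) = 0 := rfl

lemma phaseGate_apply {H : Type*} [NormedAddCommGroup H] [InnerProductSpace ℂ H]
    (φ : ℝ) (w : WithLp 2 (H × H)) :
    phaseGate φ w = w + (Complex.exp ((φ : ℂ) * Complex.I) - 1) • ket0 (bra0 w) := by
  have h : w = ket0 (bra0 w) + ket1 (bra1 w) := by
    apply WithLp.ofLp_injective
    ext <;> simp [ket0, ket1, bra0, bra1]
  have h' : phaseGate φ w =
      Complex.exp ((φ : ℂ) * Complex.I) • ket0 (bra0 w) + ket1 (bra1 w) := rfl
  rw [h']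
  nth_rewrite 3 [h]
  module

/-- **Bottom-left block of the compiled selective phase.**
With `S̃ := C†(P_φ ⊗ I)C`, `Q := Υ†Υ` and `B := (⟨1| ⊗ I) S̃ (|0⟩ ⊗ I)`, one has
`B†B = |e^{iφ} − 1|² (Q − Q²)`. -/
theorem compiled_selective_phase_bottom_left_block
    {H : Type*} [NormedAddCommGroup H] [InnerProductSpace ℂ H] [FiniteDimensional ℂ H]
    (C : WithLp 2 (H × H) →L[ℂ] WithLp 2 (H × H))
    (hC : C ∈ unitary (WithLp 2 (H × H) →L[ℂ] WithLp 2 (H × H)))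
    (Υ Φ : H →L[ℂ] H)
    (hblock : ∀ v : H, C (ket0 v) = ket0 (Υ v) + ket1 (Φ v))
    (φ : ℝ)
    (Stilde : WithLp 2 (H × H) →L[ℂ] WithLp 2 (H × H))
    (hS : Stilde = ContinuousLinearMap.adjoint C * phaseGate φ * C)
    (Q : H →L[ℂ] H) (hQ : Q = ContinuousLinearMap.adjoint Υ * Υ)
    (B : H →L[ℂ] H)
    (hB : B = bra1.comp (Stilde.comp ket0)) :
    ContinuousLinearMap.adjoint B * B =
      ((‖Complex.exp ((φ : ℂ) * Complex.I) - 1‖ ^ 2 : ℝ) : ℂ) • (Q - Q * Q) := by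
  have hl : ContinuousLinearMap.adjoint C * C = 1 := (Unitary.mem_iff.mp hC).1
  have hr : C * ContinuousLinearMap.adjoint C = 1 := (Unitary.mem_iff.mp hC).2
  have hl' (w) : ContinuousLinearMap.adjoint C (C w) = w := DFunLike.congr_fun hl w
  have hr' (w) : C (ContinuousLinearMap.adjoint C w) = w := DFunLike.congr_fun hr w
  have hB' (v : H) : B v = (Complex.exp ((φ : ℂ) * Complex.I) - 1) •
      bra1 (ContinuousLinearMap.adjoint C (ket0 (Υ v))) := by
    have h : B v = bra1 (ContinuousLinearMap.adjoint C (phaseGate φ (C (ket0 v)))) := by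
      rw [hB, hS]
      rfl
    rw [h, phaseGate_apply, map_add, hl', map_add, bra1_ket0, zero_add, hblock, map_add,
      bra0_ket0, bra0_ket1, add_zero, map_smul, map_smul]
  have hQ' (v : H) : bra0 (ContinuousLinearMap.adjoint C (ket0 (Υ v))) = Q v := by
    refine ext_inner_left ℂ fun u => ?_
    rw [← inner_ket0_left, ContinuousLinearMap.adjoint_inner_right, hblock, ← inner_conj_symm,
      inner_ket0_left, map_add, bra0_ket0, bra0_ket1, add_zero, inner_conj_symm, hQ,
      mul_apply_eq_comp, ContinuousLinearMap.adjoint_inner_right]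
  have hQsa (u v : H) : ⟪Q u, v⟫_ℂ = ⟪u, Q v⟫_ℂ := by
    simp [hQ, ContinuousLinearMap.adjoint_inner_left, ContinuousLinearMap.adjoint_inner_right]
  ext v
  refine ext_inner_left ℂ fun u => ?_
  have hz (z : ℂ) : (starRingEnd ℂ) z * z = ((‖z‖ ^ 2 : ℝ) : ℂ) := by
    rw [Complex.conj_mul']; push_cast; rfl
  have hΥ : ⟪Υ u, Υ v⟫_ℂ = ⟪u, Q v⟫_ℂ := by
    rw [hQ, mul_apply_eq_comp, ContinuousLinearMap.adjoint_inner_right]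
  rw [mul_apply_eq_comp, ContinuousLinearMap.adjoint_inner_right, hB', hB',
    inner_smul_left, inner_smul_right, inner_bra1_bra1, hQ', hQ',
    ContinuousLinearMap.adjoint_inner_right, hr', inner_ket0_left, bra0_ket0, hΥ, hQsa,
    ← mul_assoc, hz, smul_apply, inner_smul_right,
    sub_apply, inner_sub_right, mul_apply_eq_comp]
end
end

section
/- Let H be a finite-dimensional complex inner product space, let C be a unitary operator on ℂ² ⊗ H, and let Υ, Φ be linear operators on H such that C(|0⟩ ⊗ v) = |0⟩ ⊗ (Υ v) + |1⟩ ⊗ (Φ v) for all v ∈ H. Fix φ ∈ ℝ, let P_φ := e^{iφ}|0⟩⟨0| + |1⟩⟨1|, set S̃ := C† (P_φ ⊗ I) C and Q := Υ†Υ. Let Π₀ be an orthogonal projection on H with Q Π₀ = Π₀ Q = Π₀. Define the linear map E_φ : H → ℂ² ⊗ H by E_φ v := S̃(|0⟩ ⊗ v) − |0⟩ ⊗ (S_φ(Π₀) v), where S_φ(Π₀) := I + (e^{iφ} − 1)Π₀. Then E_φ† E_φ = |e^{iφ} − 1|² (Q − Π₀) as operators on H. -/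
/- We model the tensor product `ℂ² ⊗ H` by the L²-product `WithLp 2 (H × H)`,
identifying `|0⟩ ⊗ v` with `(v, 0)` and `|1⟩ ⊗ v` with `(0, v)`. -/

noncomputable section

variable {H : Type*} [NormedAddCommGroup H] [InnerProductSpace ℂ H]

theorem inner_ket0_ket0 {H : Type*} [NormedAddCommGroup H] [InnerProductSpace ℂ H] (v w : H) :
    inner ℂ (ket0 v) (ket0 w) = inner ℂ v w := by
  simp [ket0, WithLp.prod_inner_apply]

theorem inner_ket0_ket1 {H : Type*} [NormedAddCommGroup H] [InnerProductSpace ℂ H] (v w : H) :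
    inner ℂ (ket0 v) (ket1 w) = 0 := by
  simp [ket0, ket1, WithLp.prod_inner_apply]

theorem inner_ket1_ket0 {H : Type*} [NormedAddCommGroup H] [InnerProductSpace ℂ H] (v w : H) :
    inner ℂ (ket1 v) (ket0 w) = 0 := by
  simp [ket0, ket1, WithLp.prod_inner_apply]

theorem phaseGate_apply_ket0_add_ket1 {H : Type*} [NormedAddCommGroup H]
    [InnerProductSpace ℂ H] (φ : ℝ) (v w : H) :
    phaseGate φ (ket0 v + ket1 w) =
      (ket0 v + ket1 w) + (Complex.exp ((φ : ℂ) * Complex.I) - 1) • ket0 v := by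
  have h0 : bra0 (ket0 v + ket1 w) = v := by simp [bra0, ket0, ket1]
  have h1 : bra1 (ket0 v + ket1 w) = w := by simp [bra1, ket0, ket1]
  simp only [phaseGate, add_apply, smul_apply,
    ContinuousLinearMap.comp_apply, h0, h1]
  module

/-- **Error operator of the compiled selective phase.**
With `S̃ := C†(P_φ ⊗ I)C`, `Q := Υ†Υ`, and an orthogonal projection `Π₀` satisfying
`QΠ₀ = Π₀Q = Π₀`, the error map `E_φ v := S̃(|0⟩ ⊗ v) − |0⟩ ⊗ (S_φ(Π₀)v)` satisfies
`E_φ†E_φ = |e^{iφ} − 1|² (Q − Π₀)`. -/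
theorem compiled_selective_phase_error_operator
    {H : Type*} [NormedAddCommGroup H] [InnerProductSpace ℂ H] [FiniteDimensional ℂ H]
    (C : WithLp 2 (H × H) →L[ℂ] WithLp 2 (H × H))
    (hC : C ∈ unitary (WithLp 2 (H × H) →L[ℂ] WithLp 2 (H × H)))
    (Υ Φ : H →L[ℂ] H)
    (hblock : ∀ v : H, C (ket0 v) = ket0 (Υ v) + ket1 (Φ v))
    (φ : ℝ)
    (Stilde : WithLp 2 (H × H) →L[ℂ] WithLp 2 (H × H))
    (hS : Stilde = ContinuousLinearMap.adjoint C * phaseGate φ * C)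
    (Q : H →L[ℂ] H) (hQ : Q = ContinuousLinearMap.adjoint Υ * Υ)
    (Pi0 : H →L[ℂ] H)
    (hPi0idem : Pi0 * Pi0 = Pi0) (hPi0sa : ContinuousLinearMap.adjoint Pi0 = Pi0)
    (hQPi0 : Q * Pi0 = Pi0) (hPi0Q : Pi0 * Q = Pi0)
    (Ephi : H →L[ℂ] WithLp 2 (H × H))
    (hE : ∀ v : H, Ephi v =
      Stilde (ket0 v) - ket0 ((1 + (Complex.exp ((φ : ℂ) * Complex.I) - 1) • Pi0) v)) :
    (ContinuousLinearMap.adjoint Ephi).comp Ephi =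
      ((‖Complex.exp ((φ : ℂ) * Complex.I) - 1‖ ^ 2 : ℝ) : ℂ) • (Q - Pi0) := by
  set c : ℂ := Complex.exp ((φ : ℂ) * Complex.I) - 1 with hc
  have hCC (x) : ContinuousLinearMap.adjoint C (C x) = x :=
    DFunLike.congr_fun (Unitary.mem_iff.mp hC).1 x
  have hCC' (x) : C (ContinuousLinearMap.adjoint C x) = x :=
    DFunLike.congr_fun (Unitary.mem_iff.mp hC).2 x
  have hEv (v : H) :
      Ephi v = c • (ContinuousLinearMap.adjoint C (ket0 (Υ v)) - ket0 (Pi0 v)) := by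
    have hSv : Stilde (ket0 v) = ket0 v + c • ContinuousLinearMap.adjoint C (ket0 (Υ v)) := by
      rw [hS, mul_apply_eq_comp, mul_apply_eq_comp, hblock,
        phaseGate_apply_ket0_add_ket1, ← hblock, map_add, hCC, map_smul]
    rw [hE, hSv]
    simp only [add_apply, one_apply_eq_self,
      smul_apply, map_add, map_smul]
    module
  have hΥ (v w : H) : inner ℂ (Υ v) (Υ w) = inner ℂ v (Q w) := by
    rw [hQ, mul_apply_eq_comp, ContinuousLinearMap.adjoint_inner_right]
  have hP (v w : H) : inner ℂ (Pi0 v) w = inner ℂ v (Pi0 w) := by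
    rw [← ContinuousLinearMap.adjoint_inner_right, hPi0sa]
  have hPP (v : H) : Pi0 (Pi0 v) = Pi0 v := DFunLike.congr_fun hPi0idem v
  have hQP (v : H) : Q (Pi0 v) = Pi0 v := DFunLike.congr_fun hQPi0 v
  have hPQ (v : H) : Pi0 (Q v) = Pi0 v := DFunLike.congr_fun hPi0Q v
  have hcc : (starRingEnd ℂ) c * c = ((‖c‖ ^ 2 : ℝ) : ℂ) := by
    rw [Complex.conj_mul']
    push_cast
    rfl
  ext w
  refine ext_inner_left ℂ fun v => ?_
  rw [ContinuousLinearMap.comp_apply, ContinuousLinearMap.adjoint_inner_right, hEv, hEv,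
    smul_apply, inner_smul_left, inner_smul_right, inner_smul_right,
    ← mul_assoc, hcc]
  congr 1
  rw [inner_sub_left, inner_sub_right, inner_sub_right,
    ContinuousLinearMap.adjoint_inner_left, ContinuousLinearMap.adjoint_inner_left,
    ContinuousLinearMap.adjoint_inner_right, hCC', hblock, hblock, inner_add_left,
    inner_add_right]
  simp only [inner_ket0_ket0, inner_ket0_ket1, inner_ket1_ket0, hΥ, hP, hPP, hQP, hPQ,
    sub_apply, inner_sub_right]
  ring
end
end

section
/- (Selective phase gadget.) Let H₁, H₂ be finite-dimensional complex inner product spaces, let C be a unitary operator on ℂ² ⊗ H₂, and let Υ, Φ be linear operators on H₂ such that C(|0⟩ ⊗ v) = |0⟩ ⊗ (Υ v) + |1⟩ ⊗ (Φ v) for all v ∈ H₂. Fix φ ∈ ℝ, let P_φ := e^{iφ}|0⟩⟨0| + |1⟩⟨1|, and set S̃_φ := C† (P_φ ⊗ I) C and Q := Υ†Υ. Let Π₀ be an orthogonal projection on H₂ with Q Π₀ = Π₀ Q = Π₀ and ‖Q − Π₀‖ ≤ ε² for some ε ∈ (0,1). Let T : H₁ → H₂ be a linear isometry and Π_π an orthogonal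 projection on H₁ satisfying Π₀ ∘ T = T ∘ Π_π. Then ‖ S̃_φ ∘ (|0⟩ ⊗ I) ∘ T − (|0⟩ ⊗ I) ∘ T ∘ S_φ(Π_π) ‖ ≤ 2ε, where (|0⟩ ⊗ I) : H₂ → ℂ² ⊗ H₂ is the map v ↦ |0⟩ ⊗ v and S_φ(Π_π) := I + (e^{iφ} − 1)Π_π. -/
/- We model the tensor product `ℂ² ⊗ H` by the L²-product `WithLp 2 (H × H)`,
identifying `|0⟩ ⊗ v` with `(v, 0)` and `|1⟩ ⊗ v` with `(0, v)`. -/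

noncomputable section

variable {H : Type*} [NormedAddCommGroup H] [InnerProductSpace ℂ H]

theorem norm_ket0_add_ket1_sq (u v : H) : ‖ket0 u + ket1 v‖ ^ 2 = ‖u‖ ^ 2 + ‖v‖ ^ 2 := by
  rw [WithLp.prod_norm_sq_eq_of_L2]
  simp [ket0, ket1]

theorem norm_ket0 (u : H) : ‖ket0 u‖ = ‖u‖ := by
  have h := norm_ket0_add_ket1_sq u 0
  rw [map_zero, add_zero, norm_zero] at h
  exact (sq_eq_sq₀ (norm_nonneg _) (norm_nonneg _)).1 (by linarith)

theorem phaseGate_ket0_add_ket1 (φ : ℝ) (u v : H) :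
    phaseGate φ (ket0 u + ket1 v) = Complex.exp ((φ : ℂ) * Complex.I) • ket0 u + ket1 v := by
  simp [phaseGate, ket0, ket1, bra0, bra1]

/-- If `A†A` is within `ε²` of the projection `p`, then `A` has norm at most `ε` on `ker p`. -/
theorem norm_apply_le_of_adjoint_mul_self_near [CompleteSpace H] {A p : H →L[ℂ] H} {ε : ℝ}
    (hε : 0 ≤ ε) (h : ‖ContinuousLinearMap.adjoint A * A - p‖ ≤ ε ^ 2) {b : H} (hb : p b = 0) :
    ‖A b‖ ≤ ε * ‖b‖ := by
  refine le_of_sq_le_sq ?_ (by positivity)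
  have h1 : ‖A b‖ ^ 2 = RCLike.re (inner ℂ ((ContinuousLinearMap.adjoint A * A - p) b) b) := by
    rw [ContinuousLinearMap.apply_norm_sq_eq_inner_adjoint_left]
    simp [hb]
  calc ‖A b‖ ^ 2 ≤ ‖(ContinuousLinearMap.adjoint A * A - p) b‖ * ‖b‖ :=
        h1.le.trans (re_inner_le_norm _ _)
    _ ≤ (ε ^ 2 * ‖b‖) * ‖b‖ := by
        gcongr
        exact ContinuousLinearMap.le_of_opNorm_le _ h b
    _ = (ε * ‖b‖) ^ 2 := by ring

/-- **Selective phase gadget (Proposition: stationary selective phase).**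
Let `C` be unitary on `ℂ² ⊗ H₂` with block column `(Υ, Φ)ᵀ`, let
`S̃_φ := C†(P_φ ⊗ I)C` and `Q := Υ†Υ`. If `Π₀` is an orthogonal projection with
`QΠ₀ = Π₀Q = Π₀` and `‖Q − Π₀‖ ≤ ε²`, and `T : H₁ → H₂` is a linear isometry with
`Π₀ ∘ T = T ∘ Π_π` for an orthogonal projection `Π_π` on `H₁`, then
`‖S̃_φ(|0⟩ ⊗ I)T − (|0⟩ ⊗ I)T S_φ(Π_π)‖ ≤ 2ε`. -/
theorem selective_phase_gadget
    {H₁ H₂ : Type*} [NormedAddCommGroup H₁] [InnerProductSpace ℂ H₁]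
    [FiniteDimensional ℂ H₁]
    [NormedAddCommGroup H₂] [InnerProductSpace ℂ H₂] [FiniteDimensional ℂ H₂]
    (C : WithLp 2 (H₂ × H₂) →L[ℂ] WithLp 2 (H₂ × H₂))
    (hC : C ∈ unitary (WithLp 2 (H₂ × H₂) →L[ℂ] WithLp 2 (H₂ × H₂)))
    (Υ Φ : H₂ →L[ℂ] H₂)
    (hblock : ∀ v : H₂, C (ket0 v) = ket0 (Υ v) + ket1 (Φ v))
    (φ : ℝ)
    (Stilde : WithLp 2 (H₂ × H₂) →L[ℂ] WithLp 2 (H₂ × H₂))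
    (hS : Stilde = ContinuousLinearMap.adjoint C * phaseGate φ * C)
    (Q : H₂ →L[ℂ] H₂) (hQ : Q = ContinuousLinearMap.adjoint Υ * Υ)
    (Pi0 : H₂ →L[ℂ] H₂)
    (hPi0idem : Pi0 * Pi0 = Pi0) (hPi0sa : ContinuousLinearMap.adjoint Pi0 = Pi0)
    (hQPi0 : Q * Pi0 = Pi0) (hPi0Q : Pi0 * Q = Pi0)
    (ε : ℝ) (hε0 : 0 < ε) (hε1 : ε < 1)
    (hQnear : ‖Q - Pi0‖ ≤ ε ^ 2)
    (T : H₁ →ₗᵢ[ℂ] H₂)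
    (Pipi : H₁ →L[ℂ] H₁)
    (hPipiIdem : Pipi * Pipi = Pipi) (hPipiSa : ContinuousLinearMap.adjoint Pipi = Pipi)
    (hIntertwine : Pi0.comp T.toContinuousLinearMap = T.toContinuousLinearMap.comp Pipi) :
    ‖Stilde.comp ((ket0 (H := H₂)).comp T.toContinuousLinearMap) -
      ((ket0 (H := H₂)).comp T.toContinuousLinearMap).comp
        (1 + (Complex.exp ((φ : ℂ) * Complex.I) - 1) • Pipi)‖ ≤ 2 * ε := by
  have hCC : ContinuousLinearMap.adjoint C * C = 1 := by
    rw [← ContinuousLinearMap.star_eq_adjoint]; exact (Unitary.mem_iff.1 hC).1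
  have hCC' : C * ContinuousLinearMap.adjoint C = 1 := by
    rw [← ContinuousLinearMap.star_eq_adjoint]; exact (Unitary.mem_iff.1 hC).2
  have hCnorm : ∀ w, ‖C w‖ = ‖w‖ := C.norm_map_iff_adjoint_comp_self.2 hCC
  have hCinv : ∀ w, C (ContinuousLinearMap.adjoint C w) = w := fun w => DFunLike.congr_fun hCC' w
  have hblock_sq : ∀ v, ‖Υ v‖ ^ 2 + ‖Φ v‖ ^ 2 = ‖v‖ ^ 2 := fun v => by
    rw [← norm_ket0_add_ket1_sq, ← hblock, hCnorm, norm_ket0]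
  subst hS hQ
  have hΦ : ∀ x, Φ (Pi0 x) = 0 := fun x => by
    have h1 := Υ.apply_norm_sq_eq_inner_adjoint_left (Pi0 x)
    have h2 : (ContinuousLinearMap.adjoint Υ * Υ) (Pi0 x) = Pi0 x := DFunLike.congr_fun hQPi0 x
    have h3 := hblock_sq (Pi0 x)
    rw [← ContinuousLinearMap.mul_def, h2, inner_self_eq_norm_sq] at h1
    rw [← norm_eq_zero, ← sq_eq_zero_iff]
    linarith
  have hcompl : ∀ x, ‖x - Pi0 x‖ ≤ ‖x‖ := fun x => by
    have h1 : inner ℂ (x - Pi0 x) (Pi0 x) = 0 := by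
      have h2 : Pi0 (Pi0 x) = Pi0 x := DFunLike.congr_fun hPi0idem x
      rw [← ContinuousLinearMap.adjoint_inner_left, hPi0sa, map_sub, h2, sub_self, inner_zero_left]
    have h3 := norm_add_sq_eq_norm_sq_add_norm_sq_of_inner_eq_zero _ _ h1
    rw [sub_add_cancel] at h3
    exact le_of_sq_le_sq (by nlinarith [norm_nonneg (Pi0 x)]) (norm_nonneg _)
  have hphase : ‖Complex.exp ((φ : ℂ) * Complex.I) - 1‖ ≤ 2 := by
    refine (norm_sub_le _ _).trans ?_
    rw [Complex.norm_exp_ofReal_mul_I, norm_one]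
    norm_num
  set c := Complex.exp ((φ : ℂ) * Complex.I) with hc
  refine ContinuousLinearMap.opNorm_le_bound _ (by positivity) fun h => ?_
  have hT : T (Pipi h) = Pi0 (T h) := (DFunLike.congr_fun hIntertwine h).symm
  have hker : Pi0 (T h - Pi0 (T h)) = 0 := by
    rw [map_sub, sub_eq_zero]
    exact (DFunLike.congr_fun hPi0idem (T h)).symm
  change ‖ContinuousLinearMap.adjoint C (phaseGate φ (C (ket0 (T h)))) -
    ket0 (T (h + (c - 1) • Pipi h))‖ ≤ _
  have hmap : C (ContinuousLinearMap.adjoint C (phaseGate φ (C (ket0 (T h)))) -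
      ket0 (T (h + (c - 1) • Pipi h))) = (c - 1) • ket0 (Υ (T h - Pi0 (T h))) := by
    rw [hblock, phaseGate_ket0_add_ket1, ← hc]
    simp only [map_sub, map_add, map_smul, hCinv, hblock, hT, hΦ, map_zero]
    module
  rw [← hCnorm, hmap, norm_smul, norm_ket0]
  calc ‖c - 1‖ * ‖Υ (T h - Pi0 (T h))‖ ≤ 2 * (ε * ‖T h - Pi0 (T h)‖) := by
        gcongr
        exact norm_apply_le_of_adjoint_mul_self_near hε0.le hQnear hker
    _ ≤ 2 * (ε * ‖T h‖) := by gcongr; exact hcompl _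
    _ = 2 * ε * ‖h‖ := by rw [T.norm_map]; ring
end
end
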